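/- The decomposition of C(n) given by C_1(n) = {J_1, J_2, …, J_{n+1}} and C_i(n) = {I_{i-1}} for 2 ≤ i ≤ d is a (1/(n+1), d)-homogeneous colouring of C(n), but it is NOT a (1/n, d)-homogeneous colouring of C(n): for the testing interval L_{n+2} one has |C(n) ∩ L_{n+2}| = n + d > d, |C_1(n) ∩ L_{n+2}| = n+1 and |C_i(n) ∩ L_{n+2}| = 1 for 2 ≤ i ≤ d, so the homogeneity inequality holds with η' = 1/(n+1) but fails with η = 1/n. -/

import Mathlib

/-- Encoding of dyadic intervals: an interval of `D_j` (the dyadic intervals of length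
`2 ^ (-j)` in `[0,1]`) is encoded by its position `i < 2 ^ j`, representing
`[i / 2 ^ j, (i + 1) / 2 ^ j]`; a dyadic testing interval `L ∈ D` with `|L| ≥ 2 ^ (-j)` is
encoded by a scale `k ≤ j` and a position `m < 2 ^ k`, representing
`[m / 2 ^ k, (m + 1) / 2 ^ k]`.  For a collection `C ⊆ D_j`, `restrict j k m C` is the
subcollection `C ∩ L = {i ∈ C : i ⊆ L}` of elements of `C` contained in the testing
interval `L = [m / 2 ^ k, (m + 1) / 2 ^ k]`. -/
def restrict (j k m : ℕ) (C : Finset ℕ) : Finset ℕ :=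
  C.filter fun i => i / 2 ^ (j - k) = m

/-- `col` is a decomposition of `C` into `d` pairwise disjoint (possibly empty) classes. -/
def IsColouring (d : ℕ) (C : Finset ℕ) (col : Fin d → Finset ℕ) : Prop :=
  (∀ i, col i ⊆ C) ∧ (∀ i₁ i₂ : Fin d, i₁ ≠ i₂ → Disjoint (col i₁) (col i₂)) ∧
    ∀ x ∈ C, ∃ i, x ∈ col i

/-- `col` is an `(η, d)`-homogeneous colouring of `C ⊆ D_j`: it is a decomposition of `C`
into `d` pairwise disjoint classes such that for every dyadic testing interval `L` of
length `≥ 2 ^ (-j)`, either `|C ∩ L| > d` and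
`η * max_{1 ≤ i ≤ d} |C_i ∩ L| ≤ min_{1 ≤ i ≤ d} |C_i ∩ L|`, or else `|C ∩ L| ≤ d` and
`|C_i ∩ L| ≤ 1` for every `1 ≤ i ≤ d`. -/
def IsHomogeneous (j d : ℕ) (η : ℝ) (C : Finset ℕ) (col : Fin d → Finset ℕ) : Prop :=
  IsColouring d C col ∧
    ∀ k ≤ j, ∀ m < 2 ^ k,
      (d < (restrict j k m C).card ∧
        ∀ i₁ i₂ : Fin d,
          η * (restrict j k m (col i₁)).card ≤ ((restrict j k m (col i₂)).card : ℝ)) ∨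
      ((restrict j k m C).card ≤ d ∧ ∀ i : Fin d, (restrict j k m (col i)).card ≤ 1)

/- Setup for the counterexample of Section 3 (with `d = 2 ^ a`, `η = 1 / n`,
`j ≥ n + a + 1`): a chain of dyadic intervals `L_1 ⊂ L_2 ⊂ … ⊂ L_{n+2}` with
`L_i ∈ D_{j-a-i+1}` (so `L i` is the position of `L_i` at scale `j + 1 - (a + i)`, and
`L_i ⊂ L_{i+1}` reads `L (i+1) = L i / 2`); `P_i = L_{i+1} \ L_i` is the dyadic brother
of `L_i` in `L_{i+1}` (same scale as `L_i`, same parent, different position); pairwise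
distinct `I_1, …, I_{d-1} ∈ D_j` with `I_i ⊆ L_1` (i.e. `I i / 2 ^ a = L 1`), and
`J_1, …, J_{n+1} ∈ D_j` with `J_i ⊆ P_i` (i.e. `J i / 2 ^ (a + i - 1) = P i`).
For `0 ≤ k ≤ n`, `C(k) = {I_1, …, I_{d-1}} ∪ {J_{n-k+1}, …, J_{n+1}}` is encoded as
`(Finset.Icc 1 (2 ^ a - 1)).image I ∪ (Finset.Icc (n + 1 - k) (n + 1)).image J`.
Colour classes are indexed by `i : Fin (2 ^ a)`, index `i` corresponding to colour
`i.val + 1 ∈ {1, …, d}`. -/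

theorem div_two_pow_eq_of_le {x y s e : ℕ} (h : x / 2 ^ s = y / 2 ^ s) (hse : s ≤ e) :
    x / 2 ^ e = y / 2 ^ e := by
  obtain ⟨t, rfl⟩ := Nat.exists_eq_add_of_le hse
  rw [pow_add, ← Nat.div_div_eq_div_mul, ← Nat.div_div_eq_div_mul, h]

/-- An interval contained in one member of a dyadic chain is contained in all later ones. -/
theorem div_two_pow_eq_of_chain {a s₀ N x : ℕ} {L : ℕ → ℕ} (hs₀ : 1 ≤ s₀)
    (hchain : ∀ i, s₀ ≤ i → i < N → L (i + 1) = L i / 2)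
    (hx : x / 2 ^ (a + s₀ - 1) = L s₀) {s : ℕ} (hs : s₀ ≤ s) (hsN : s ≤ N) :
    x / 2 ^ (a + s - 1) = L s := by
  induction s, hs using Nat.le_induction with
  | base => exact hx
  | succ s hs ih =>
    rw [hchain s hs hsN, ← ih (by omega), Nat.div_div_eq_div_mul, ← pow_succ]
    congr 2
    omega

theorem restrict_union (j k m : ℕ) (A B : Finset ℕ) :
    restrict j k m (A ∪ B) = restrict j k m A ∪ restrict j k m B :=
  Finset.filter_union ..

theorem card_restrict_le (j k m : ℕ) (A : Finset ℕ) : (restrict j k m A).card ≤ A.card :=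
  Finset.card_filter_le ..

theorem restrict_eq_self {j k m : ℕ} {A : Finset ℕ} (h : ∀ x ∈ A, x / 2 ^ (j - k) = m) :
    restrict j k m A = A :=
  Finset.filter_true_of_mem h

theorem disjoint_restrict {A B : Finset ℕ} (h : Disjoint A B) (j k m : ℕ) :
    Disjoint (restrict j k m A) (restrict j k m B) :=
  Finset.disjoint_filter_filter h

/-- Singletons `{I 1}, …, {I (d - 1)}` together with one further class `B`. -/
theorem isColouring_singletons {d : ℕ} (hd : 0 < d) {I : ℕ → ℕ} {B : Finset ℕ}
    (hI : Set.InjOn I (Finset.Icc 1 (d - 1)))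
    (hIB : Disjoint ((Finset.Icc 1 (d - 1)).image I) B) :
    IsColouring d ((Finset.Icc 1 (d - 1)).image I ∪ B)
      (fun i : Fin d => if i.val = 0 then B else {I i.val}) := by
  have mem (i : Fin d) (hi : i.val ≠ 0) : i.val ∈ Finset.Icc 1 (d - 1) := by
    have := i.isLt
    rw [Finset.mem_Icc]
    omega
  have not_mem (i : Fin d) (hi : i.val ≠ 0) : I i.val ∉ B :=
    Finset.disjoint_left.1 hIB (Finset.mem_image_of_mem I (mem i hi))
  refine ⟨fun i => ?_, fun i₁ i₂ hne => ?_, fun x hx => ?_⟩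
  · dsimp only
    split_ifs with hi
    · exact Finset.subset_union_right
    · exact Finset.singleton_subset_iff.2
        (Finset.mem_union_left _ (Finset.mem_image_of_mem I (mem i hi)))
  · dsimp only
    split_ifs with h₁ h₂ h₂
    · exact absurd (Fin.ext (h₁.trans h₂.symm)) hne
    · exact Finset.disjoint_singleton_right.2 (not_mem i₂ h₂)
    · exact Finset.disjoint_singleton_left.2 (not_mem i₁ h₁)
    · rw [Finset.disjoint_singleton]
      exact fun h => hne (Fin.ext (hI (mem i₁ h₁) (mem i₂ h₂) h))
  · rcases Finset.mem_union.1 hx with hx | hx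
    · obtain ⟨t, ht, rfl⟩ := Finset.mem_image.1 hx
      rw [Finset.mem_Icc] at ht
      refine ⟨⟨t, by omega⟩, ?_⟩
      simp [show t ≠ 0 by omega]
    · exact ⟨⟨0, hd⟩, by simpa using hx⟩

/-- If every testing interval containing two elements of `B` contains all of the `I i`, then
the colouring by `B` and singletons is `1 / |B|`-homogeneous. -/
theorem isHomogeneous_singletons {j d : ℕ} (hd : 0 < d) {I : ℕ → ℕ} {B : Finset ℕ}
    (hI : Set.InjOn I (Finset.Icc 1 (d - 1)))
    (hIB : Disjoint ((Finset.Icc 1 (d - 1)).image I) B)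
    (h : ∀ k ≤ j, ∀ m, 1 < (restrict j k m B).card →
      ∀ t ∈ Finset.Icc 1 (d - 1), I t / 2 ^ (j - k) = m) :
    IsHomogeneous j d (1 / (B.card : ℝ)) ((Finset.Icc 1 (d - 1)).image I ∪ B)
      (fun i : Fin d => if i.val = 0 then B else {I i.val}) := by
  refine ⟨isColouring_singletons hd hI hIB, fun k hk m _ => ?_⟩
  have hcard : ((Finset.Icc 1 (d - 1)).image I).card = d - 1 := by
    rw [Finset.card_image_of_injOn hI, Nat.card_Icc, Nat.add_sub_cancel]
  rw [restrict_union, Finset.card_union_of_disjoint (disjoint_restrict hIB j k m)]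
  rcases Nat.lt_or_ge 1 (restrict j k m B).card with hB | hB
  · left
    have hall := h k hk m hB
    rw [restrict_eq_self (Finset.forall_mem_image.2 hall), hcard]
    have hBpos : 0 < B.card := by
      have := card_restrict_le j k m B
      omega
    refine ⟨by omega, fun i₁ i₂ => ?_⟩
    have upper : (restrict j k m (if i₁.val = 0 then B else {I i₁.val})).card ≤ B.card := by
      refine (card_restrict_le ..).trans ?_
      split_ifs
      · exact le_rfl
      · simpa using Finset.card_pos.1 hBpos
    have lower : 1 ≤ (restrict j k m (if i₂.val = 0 then B else {I i₂.val})).card := by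
      split_ifs with h₂
      · exact hB.le
      · have := i₂.isLt
        rw [restrict_eq_self]
        · simp
        · simpa using hall i₂ (Finset.mem_Icc.2 (by omega))
    calc 1 / (B.card : ℝ) * (restrict j k m (if i₁.val = 0 then B else {I i₁.val})).card
        ≤ 1 / (B.card : ℝ) * B.card := by gcongr
      _ = 1 := by field_simp
      _ ≤ _ := mod_cast lower
  · right
    have := card_restrict_le j k m ((Finset.Icc 1 (d - 1)).image I)
    refine ⟨by omega, fun i => ?_⟩
    dsimp only
    split_ifs
    · exact hB
    · exact (card_restrict_le ..).trans (Finset.card_singleton _).le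

/-- **Stage `n`: the canonical colouring of `C(n)` is `(1/(n+1), d)`- but not
`(1/n, d)`-homogeneous.**  The decomposition of `C(n)` given by
`C_1(n) = {J_1, …, J_{n+1}}` and `C_i(n) = {I_{i-1}}` for `2 ≤ i ≤ d` is a
`(1/(n+1), d)`-homogeneous colouring of `C(n)` but not a `(1/n, d)`-homogeneous one:
for the testing interval `L_{n+2}` (scale `j + 1 - (a + (n + 2))`, position `L (n+2)`)
one has `|C(n) ∩ L_{n+2}| = n + d > d`, `|C_1(n) ∩ L_{n+2}| = n + 1` and
`|C_i(n) ∩ L_{n+2}| = 1` for `2 ≤ i ≤ d`, so the homogeneity inequality holds with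
`η' = 1/(n+1)` but fails with `η = 1/n`. -/
theorem stage_n_colouring_fails_eta
    (a n j : ℕ) (hn : 1 ≤ n) (hj : n + a + 1 ≤ j)
    (L P I J : ℕ → ℕ)
    (hL : ∀ i, 1 ≤ i → i ≤ n + 2 → L i < 2 ^ (j + 1 - (a + i)))
    (hchain : ∀ i, 1 ≤ i → i ≤ n + 1 → L (i + 1) = L i / 2)
    (hP : ∀ i, 1 ≤ i → i ≤ n + 1 → P i / 2 = L i / 2 ∧ P i ≠ L i)
    (hI : ∀ i, 1 ≤ i → i ≤ 2 ^ a - 1 → I i < 2 ^ j ∧ I i / 2 ^ a = L 1)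
    (hInj : ∀ i₁ i₂, 1 ≤ i₁ → i₁ ≤ 2 ^ a - 1 → 1 ≤ i₂ → i₂ ≤ 2 ^ a - 1 →
      I i₁ = I i₂ → i₁ = i₂)
    (hJ : ∀ i, 1 ≤ i → i ≤ n + 1 → J i < 2 ^ j ∧ J i / 2 ^ (a + i - 1) = P i)
    (ha : 1 ≤ a) (hn2 : 2 ≤ n) :
    (restrict j (j + 1 - (a + (n + 2))) (L (n + 2))
        ((Finset.Icc 1 (2 ^ a - 1)).image I ∪
          (Finset.Icc (n + 1 - n) (n + 1)).image J)).card = n + 2 ^ a ∧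
    2 ^ a < n + 2 ^ a ∧
    (restrict j (j + 1 - (a + (n + 2))) (L (n + 2))
        ((Finset.Icc 1 (n + 1)).image J)).card = n + 1 ∧
    (∀ i : Fin (2 ^ a), 1 ≤ i.val →
      (restrict j (j + 1 - (a + (n + 2))) (L (n + 2)) ({I i.val} : Finset ℕ)).card = 1) ∧
    IsHomogeneous j (2 ^ a) (1 / ((n : ℝ) + 1))
      ((Finset.Icc 1 (2 ^ a - 1)).image I ∪ (Finset.Icc (n + 1 - n) (n + 1)).image J)
      (fun i : Fin (2 ^ a) =>
        if i.val = 0 then (Finset.Icc 1 (n + 1)).image J else {I i.val}) ∧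
    ¬ IsHomogeneous j (2 ^ a) (1 / (n : ℝ))
      ((Finset.Icc 1 (2 ^ a - 1)).image I ∪ (Finset.Icc (n + 1 - n) (n + 1)).image J)
      (fun i : Fin (2 ^ a) =>
        if i.val = 0 then (Finset.Icc 1 (n + 1)).image J else {I i.val}) := by
  have hd : 2 ≤ 2 ^ a := by simpa using Nat.pow_le_pow_right (n := 2) (by norm_num) ha
  have hIL : ∀ t ∈ Finset.Icc 1 (2 ^ a - 1), ∀ s, 1 ≤ s → s ≤ n + 2 →
      I t / 2 ^ (a + s - 1) = L s := fun t ht s hs hsn =>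
    div_two_pow_eq_of_chain le_rfl (fun i hi hin => hchain i hi (by omega))
      (hI t (Finset.mem_Icc.1 ht).1 (Finset.mem_Icc.1 ht).2).2 hs hsn
  have hJL : ∀ i ∈ Finset.Icc 1 (n + 1), ∀ s, i < s → s ≤ n + 2 →
      J i / 2 ^ (a + s - 1) = L s := by
    intro i hi s his hsn
    rw [Finset.mem_Icc] at hi
    refine div_two_pow_eq_of_chain (s₀ := i + 1) (by omega)
      (fun r hr hrn => hchain r (by omega) (by omega)) ?_ his hsn
    rw [hchain i hi.1 hi.2, ← (hP i hi.1 hi.2).1, ← (hJ i hi.1 hi.2).2,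
      Nat.div_div_eq_div_mul, ← pow_succ]
    congr 2
    omega
  have hJne : ∀ i ∈ Finset.Icc 1 (n + 1), J i / 2 ^ (a + i - 1) ≠ L i := by
    intro i hi
    rw [Finset.mem_Icc] at hi
    rw [(hJ i hi.1 hi.2).2]
    exact (hP i hi.1 hi.2).2
  have hsep : ∀ i ∈ Finset.Icc 1 (n + 1), ∀ i' ∈ Finset.Icc 1 (n + 1), i < i' →
      ∀ e, J i / 2 ^ e = J i' / 2 ^ e → a + i' ≤ e := by
    intro i hi i' hi' hlt e he
    by_contra! hlt'
    have := Finset.mem_Icc.1 hi'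
    apply hJne i' hi'
    rw [← hJL i hi i' hlt (by omega)]
    exact (div_two_pow_eq_of_le he (by omega)).symm
  have hJinj : Set.InjOn J (Finset.Icc 1 (n + 1)) := by
    intro i hi i' hi' heq
    rcases lt_trichotomy i i' with hlt | rfl | hlt
    · have := hsep i hi i' hi' hlt 0 (by rw [heq])
      omega
    · rfl
    · have := hsep i' hi' i hi hlt 0 (by rw [heq])
      omega
  have hIinj : Set.InjOn I (Finset.Icc 1 (2 ^ a - 1)) := by
    intro i hi i' hi' heq
    rw [Finset.mem_coe, Finset.mem_Icc] at hi hi'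
    exact hInj i i' hi.1 hi.2 hi'.1 hi'.2 heq
  have hdisj : Disjoint ((Finset.Icc 1 (2 ^ a - 1)).image I)
      ((Finset.Icc 1 (n + 1)).image J) := by
    refine Finset.disjoint_left.2 (Finset.forall_mem_image.2 fun t ht hmem => ?_)
    obtain ⟨i, hi, heq⟩ := Finset.mem_image.1 hmem
    have := Finset.mem_Icc.1 hi
    apply hJne i hi
    rw [heq, hIL t ht i this.1 (by omega)]
  have hIcard : ((Finset.Icc 1 (2 ^ a - 1)).image I).card = 2 ^ a - 1 := by
    rw [Finset.card_image_of_injOn hIinj, Nat.card_Icc, Nat.add_sub_cancel]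
  have hJcard : ((Finset.Icc 1 (n + 1)).image J).card = n + 1 := by
    rw [Finset.card_image_of_injOn hJinj, Nat.card_Icc, Nat.add_sub_cancel]
  have hexp : j - (j + 1 - (a + (n + 2))) = a + (n + 2) - 1 := by omega
  have hItop : ∀ t ∈ Finset.Icc 1 (2 ^ a - 1),
      I t / 2 ^ (j - (j + 1 - (a + (n + 2)))) = L (n + 2) := fun t ht => by
    rw [hexp]
    exact hIL t ht (n + 2) (by omega) le_rfl
  have hIres := restrict_eq_self (Finset.forall_mem_image.2 hItop)
  have hJres : restrict j (j + 1 - (a + (n + 2))) (L (n + 2))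
      ((Finset.Icc 1 (n + 1)).image J) = (Finset.Icc 1 (n + 1)).image J := by
    refine restrict_eq_self (Finset.forall_mem_image.2 fun i hi => ?_)
    have := Finset.mem_Icc.1 hi
    rw [hexp]
    exact hJL i hi (n + 2) (by omega) le_rfl
  have hsingle : ∀ i : Fin (2 ^ a), 1 ≤ i.val →
      (restrict j (j + 1 - (a + (n + 2))) (L (n + 2)) ({I i.val} : Finset ℕ)).card = 1 := by
    intro i hi
    have := i.isLt
    rw [restrict_eq_self, Finset.card_singleton]
    simpa using hItop i (Finset.mem_Icc.2 (by omega))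
  have hC : (restrict j (j + 1 - (a + (n + 2))) (L (n + 2))
      ((Finset.Icc 1 (2 ^ a - 1)).image I ∪ (Finset.Icc 1 (n + 1)).image J)).card
        = n + 2 ^ a := by
    rw [restrict_union, hIres, hJres, Finset.card_union_of_disjoint hdisj, hIcard, hJcard]
    omega
  rw [Nat.add_sub_cancel_left]
  refine ⟨hC, by omega, by rw [hJres, hJcard], hsingle, ?_, fun hhom => ?_⟩
  · have hη : (n : ℝ) + 1 = ((Finset.Icc 1 (n + 1)).image J).card := by
      rw [hJcard]
      push_cast
      rfl
    rw [hη]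
    refine isHomogeneous_singletons (by omega) hIinj hdisj fun k _ m htwo t ht => ?_
    obtain ⟨x, hx, y, hy, hxy⟩ := Finset.one_lt_card.1 htwo
    rw [restrict, Finset.mem_filter, Finset.mem_image] at hx hy
    obtain ⟨⟨p, hp, rfl⟩, hxm⟩ := hx
    obtain ⟨⟨q, hq, rfl⟩, hym⟩ := hy
    wlog hlt : p < q generalizing p q
    · exact this q hq hym p hp hxy.symm hxm
        (lt_of_le_of_ne (not_lt.1 hlt) fun h => hxy (congrArg J h.symm))
    have hq' := Finset.mem_Icc.1 hq
    rw [← hym]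
    refine div_two_pow_eq_of_le (s := a + (q + 1) - 1) ?_
      (hsep p hp q hq hlt _ (hxm.trans hym.symm))
    rw [hIL t ht (q + 1) (by omega) (by omega), hJL q hq (q + 1) (by omega) (by omega)]
  · have hlt : L (n + 2) < 2 ^ (j + 1 - (a + (n + 2))) := hL (n + 2) (by omega) le_rfl
    rcases hhom.2 (j + 1 - (a + (n + 2))) (by omega) (L (n + 2)) hlt with h | h
    · have h01 := h.2 ⟨0, by omega⟩ ⟨1, by omega⟩
      have hone := hsingle ⟨1, by omega⟩ le_rfl
      simp only [if_true, one_ne_zero, if_false, hJres, hJcard, hone] at h01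
      have hn0 : (0 : ℝ) < n := by exact_mod_cast hn
      rw [one_div, inv_mul_le_iff₀ hn0] at h01
      push_cast at h01
      linarith
    · have := h.1
      omega
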